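/- The number of distinct sets of the form S(B,Γ), as B ranges over all bases of Δ whose determined positive system contains Δ_k⁺ and Γ ranges over all subsets of B, is exactly 46. -/

import Mathlib

noncomputable section

abbrev V : Type := Fin 4 → ℝ

def e (i : Fin 4) : V := Pi.single i 1

/-- The root system of type F₄ in ℝ⁴ (48 vectors). -/
def Δ : Set V :=
  (⋃ i, ({e i, -e i} : Set V)) ∪
  (⋃ (i) (j) (_ : i < j), ({e i + e j, e i - e j, -e i + e j, -e i - e j} : Set V)) ∪
  {v | ∃ s : Fin 4 → ℝ, (∀ i, s i = 1 ∨ s i = -1) ∧ v = (1 / 2 : ℝ) • ∑ i, s i • e i}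

def φ₁ : V := e 1 - e 2
def φ₂ : V := e 2 - e 3
def φ₃ : V := e 3
def φ₄ : V := (1 / 2 : ℝ) • (e 0 - e 1 - e 2 - e 3)

def φv : Fin 4 → V := ![φ₁, φ₂, φ₃, φ₄]

/-- The coordinates `n₁(α), …, n₄(α)` of `α` with respect to the basis φ₁,…,φ₄:
for every `α : V` one has `α = ∑ i, n α i • φv i`. -/
def n (α : V) : Fin 4 → ℝ :=
  ![α 1 + α 0, α 1 + α 2 + 2 * α 0, α 1 + α 2 + α 3 + 3 * α 0, 2 * α 0]

/-- The highest root δ = 2φ₁+3φ₂+4φ₃+2φ₄ = e₁+e₂. -/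
def δ : V := e 0 + e 1

/-- Compact roots: roots α with n₁(α) even. -/
def Δk : Set V := {α ∈ Δ | ∃ m : ℤ, n α 0 = 2 * m}

/-- Noncompact roots: roots α with n₁(α) odd. -/
def Δn : Set V := {α ∈ Δ | ∃ m : ℤ, n α 0 = 2 * m + 1}

/-- Δ⁺: roots with all φ-coefficients nonnegative. -/
def Δp : Set V := {α ∈ Δ | ∀ i, 0 ≤ n α i}

def Δkp : Set V := Δp ∩ Δk
def Δnp : Set V := Δp ∩ Δn

/-- A positive system of Δ: the set of roots on which some root-regular linear
functional is positive. -/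
def IsPosSystem (P : Set V) : Prop :=
  ∃ f : V →ₗ[ℝ] ℝ, (∀ α ∈ Δ, f α ≠ 0) ∧ P = {α ∈ Δ | 0 < f α}

/-- A base of Δ: a linearly independent subset of Δ such that every root is an
integral combination with coefficients all ≥ 0 or all ≤ 0. -/
def IsBase (B : Finset V) : Prop :=
  ↑B ⊆ Δ ∧ LinearIndependent ℝ (Subtype.val : {x : V // x ∈ B} → V) ∧
  ∀ α ∈ Δ, ∃ c : V → ℤ,
    α = ∑ x ∈ B, (c x : ℝ) • x ∧ ((∀ x ∈ B, 0 ≤ c x) ∨ (∀ x ∈ B, c x ≤ 0))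

/-- The positive system determined by a base B: roots whose B-coefficients are all ≥ 0. -/
def posOf (B : Finset V) : Set V :=
  {α ∈ Δ | ∃ c : V → ℤ, α = ∑ x ∈ B, (c x : ℝ) • x ∧ ∀ x ∈ B, 0 ≤ c x}

/-- `SBG B Γ` is the set of noncompact roots whose expansion over the base `B` has a
positive coefficient on some element of `Γ`. -/
def SBG (B Γ : Finset V) : Set V :=
  {β ∈ Δn | ∃ c : V → ℤ, β = ∑ x ∈ B, (c x : ℝ) • x ∧ ∃ x ∈ Γ, 0 < c x}

open Finset

/-- The `φ`-coordinates of the vectors `e i`. -/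
def shortCoords : Fin 4 → Fin 4 → ℤ :=
  ![![1, 2, 3, 2], ![1, 1, 1, 0], ![0, 1, 1, 0], ![0, 0, 1, 0]]

/-- The `φ`-coordinates of the roots of `Δ`. -/
def rootCoords : Finset (Fin 4 → ℤ) :=
  (univ.biUnion fun i => {shortCoords i, -shortCoords i}) ∪
  ((univ.filter fun p : Fin 4 × Fin 4 => p.1 < p.2).biUnion fun p =>
    {shortCoords p.1 + shortCoords p.2, shortCoords p.1 - shortCoords p.2,
      -shortCoords p.1 + shortCoords p.2, -shortCoords p.1 - shortCoords p.2}) ∪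
  univ.image fun T : Finset (Fin 4) => ![1, 2, 3, 1] - ∑ i ∈ T, shortCoords i

/-- The bases of `Δ` whose positive system contains `Δkp`, as matrices whose rows are the
`φ`-coordinates of the simple roots. -/
def simpleRoots : Fin 12 → Matrix (Fin 4) (Fin 4) ℤ :=
  ![!![1, 0, 0, 0; 0, 1, 0, 0; 0, 0, 1, 0; 0, 0, 0, 1],
    !![-1, 0, 0, 0; 1, 1, 0, 0; 0, 0, 1, 0; 0, 0, 0, 1],
    !![0, 1, 0, 0; -1, -1, 0, 0; 1, 1, 1, 0; 0, 0, 0, 1],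
    !![0, 1, 0, 0; 1, 1, 2, 0; -1, -1, -1, 0; 1, 1, 1, 1],
    !![1, 2, 2, 0; -1, -1, -2, 0; 0, 0, 1, 0; 1, 1, 1, 1],
    !![0, 1, 0, 0; 1, 1, 2, 0; 0, 0, 0, 1; -1, -1, -1, -1],
    !![-1, -2, -2, 0; 0, 1, 0, 0; 0, 0, 1, 0; 1, 1, 1, 1],
    !![1, 2, 2, 0; -1, -1, -2, 0; 1, 1, 2, 1; -1, -1, -1, -1],
    !![-1, -2, -2, 0; 0, 1, 0, 0; 1, 1, 2, 1; -1, -1, -1, -1],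
    !![1, 2, 2, 0; 1, 1, 2, 2; -1, -1, -2, -1; 0, 0, 1, 0],
    !![-1, -2, -2, 0; 2, 3, 4, 2; -1, -1, -2, -1; 0, 0, 1, 0],
    !![2, 3, 4, 2; -1, -1, -2, -2; 0, 0, 0, 1; 0, 0, 1, 0]]

/-- The inverses of the matrices `simpleRoots i`; the product `r ᵥ* coweights i` is the vector of
coefficients of `r` over the `i`-th base. -/
def coweights : Fin 12 → Matrix (Fin 4) (Fin 4) ℤ :=
  ![!![1, 0, 0, 0; 0, 1, 0, 0; 0, 0, 1, 0; 0, 0, 0, 1],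
    !![-1, 0, 0, 0; 1, 1, 0, 0; 0, 0, 1, 0; 0, 0, 0, 1],
    !![-1, -1, 0, 0; 1, 0, 0, 0; 0, 1, 1, 0; 0, 0, 0, 1],
    !![-1, -1, -2, 0; 1, 0, 0, 0; 0, 1, 1, 0; 0, 0, 1, 1],
    !![-1, -2, -2, 0; 1, 1, 0, 0; 0, 0, 1, 0; 0, 1, 1, 1],
    !![-1, -1, -2, -2; 1, 0, 0, 0; 0, 1, 1, 1; 0, 0, 1, 0],
    !![-1, -2, -2, 0; 0, 1, 0, 0; 0, 0, 1, 0; 1, 1, 1, 1],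
    !![-1, -2, -2, -2; 1, 1, 0, 0; 0, 0, 1, 1; 0, 1, 1, 0],
    !![-1, -2, -2, -2; 0, 1, 0, 0; 0, 0, 1, 1; 1, 1, 1, 0],
    !![-1, -2, -4, -2; 1, 1, 2, 0; 0, 0, 0, 1; 0, 1, 1, 0],
    !![-1, -2, -4, -2; 0, 1, 2, 0; 0, 0, 0, 1; 1, 1, 1, 0],
    !![-1, -3, -4, -2; 1, 2, 2, 0; 0, 0, 0, 1; 0, 0, 1, 0]]

open Matrix

lemma simpleRoots_mul_coweights (i : Fin 12) : simpleRoots i * coweights i = 1 := by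
  revert i; decide +kernel

lemma simpleRoots_mem_rootCoords (i : Fin 12) (k : Fin 4) : (simpleRoots i).row k ∈ rootCoords := by
  revert i k; decide +kernel

lemma coeffs_nonneg_or_nonpos (i : Fin 12) {r : Fin 4 → ℤ} (hr : r ∈ rootCoords) :
    (∀ k, 0 ≤ (r ᵥ* coweights i) k) ∨ ∀ k, (r ᵥ* coweights i) k ≤ 0 := by
  revert i r; decide +kernel

lemma coeffs_nonneg_of_compact (i : Fin 12) {r : Fin 4 → ℤ} (hr : r ∈ rootCoords)
    (hpos : ∀ k, 0 ≤ r k) (hr0 : Even (r 0)) : ∀ k, 0 ≤ (r ᵥ* coweights i) k := by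
  revert i r; decide +kernel

/-- The `φ`-coordinates of the noncompact roots. -/
def noncompactCoords : Fin 28 → Fin 4 → ℤ :=
  ![![1, 0, 0, 0], ![1, 1, 0, 0], ![1, 1, 1, 0], ![1, 1, 1, 1],
    ![1, 1, 2, 0], ![1, 1, 2, 1], ![1, 2, 2, 0], ![1, 1, 2, 2],
    ![1, 2, 2, 1], ![1, 2, 2, 2], ![1, 2, 3, 1], ![1, 2, 3, 2],
    ![1, 2, 4, 2], ![1, 3, 4, 2], ![-1, 0, 0, 0], ![-1, -1, 0, 0],
    ![-1, -1, -1, 0], ![-1, -1, -1, -1], ![-1, -1, -2, 0], ![-1, -1, -2, -1],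
    ![-1, -2, -2, 0], ![-1, -1, -2, -2], ![-1, -2, -2, -1], ![-1, -2, -2, -2],
    ![-1, -2, -3, -1], ![-1, -2, -3, -2], ![-1, -2, -4, -2], ![-1, -3, -4, -2]]

lemma image_noncompactCoords :
    univ.image noncompactCoords = rootCoords.filter fun r => Odd (r 0) := by
  decide +kernel

lemma noncompactCoords_mem_rootCoords (t : Fin 28) : noncompactCoords t ∈ rootCoords :=
  (mem_filter.1 (image_noncompactCoords ▸ mem_image_of_mem _ (mem_univ t))).1

lemma noncompactCoords_injective : Function.Injective noncompactCoords := by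
  unfold Function.Injective; decide +kernel

/-- Bit `t` of `supportMask i k` tells whether the `t`-th noncompact root has a positive
coefficient on the `k`-th simple root of the `i`-th base. -/
def supportMask : Fin 12 → Fin 4 → ℕ :=
  ![![16383, 16382, 16380, 16296],
    ![32576, 16382, 16380, 16296],
    ![32576, 65520, 16380, 16296],
    ![32576, 65520, 130976, 16296],
    ![32576, 393088, 130976, 16296],
    ![32576, 65520, 130976, 261120],
    ![1440384, 393088, 130976, 16296],
    ![32576, 393088, 130976, 261120],
    ![1440384, 393088, 130976, 261120],
    ![32576, 393088, 1048320, 261120],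
    ![1440384, 393088, 1048320, 261120],
    ![32576, 3145536, 1048320, 261120]]

lemma testBit_supportMask (i : Fin 12) (k : Fin 4) (t : Fin 28) :
    (supportMask i k).testBit t = true ↔ 0 < (noncompactCoords t ᵥ* coweights i) k := by
  revert i k t; decide +kernel

/-- Bit `t` of `unionMask (i, s)` tells whether the `t`-th noncompact root has a positive
coefficient, over the `i`-th base, on a simple root with index in `s`. -/
def unionMask (p : Fin 12 × Finset (Fin 4)) : ℕ :=
  ((if 0 ∈ p.2 then supportMask p.1 0 else 0) ||| (if 1 ∈ p.2 then supportMask p.1 1 else 0)) |||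
  ((if 2 ∈ p.2 then supportMask p.1 2 else 0) ||| (if 3 ∈ p.2 then supportMask p.1 3 else 0))

lemma testBit_unionMask (i : Fin 12) (s : Finset (Fin 4)) (t : Fin 28) :
    (unionMask (i, s)).testBit t = true ↔
      ∃ k ∈ s, 0 < (noncompactCoords t ᵥ* coweights i) k := by
  have h (k : Fin 4) : (if k ∈ s then supportMask i k else 0).testBit t = true ↔
      k ∈ s ∧ 0 < (noncompactCoords t ᵥ* coweights i) k := by
    rw [← testBit_supportMask]
    split_ifs with hk <;> simp [hk]
  simp only [unionMask, Nat.testBit_or, Bool.or_eq_true, h, Fin.exists_fin_succ]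
  simp [or_assoc]

lemma unionMask_lt (p : Fin 12 × Finset (Fin 4)) : unionMask p < 2 ^ 28 := by
  revert p; decide +kernel

lemma card_image_unionMask : (univ.image unionMask).card = 46 := by
  decide +kernel

lemma exists_chamber (h : Fin 4 → ℤ) (hne : ∀ r ∈ rootCoords, h ⬝ᵥ r ≠ 0)
    (hpos : ∀ r ∈ rootCoords, (∀ k, 0 ≤ r k) → Even (r 0) → 0 < h ⬝ᵥ r) :
    ∃ i, ∀ k, 0 < h ⬝ᵥ (simpleRoots i).row k := by
  have p1 := hpos ![0, 1, 0, 0] (by decide +kernel) (by decide) (by decide)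
  have p2 := hpos ![0, 0, 1, 0] (by decide +kernel) (by decide) (by decide)
  have p3 := hpos ![0, 0, 0, 1] (by decide +kernel) (by decide) (by decide)
  have p4 := hpos ![2, 3, 4, 2] (by decide +kernel) (by decide) (by decide)
  have a1 := hne _ (noncompactCoords_mem_rootCoords 0)
  have a2 := hne _ (noncompactCoords_mem_rootCoords 1)
  have a3 := hne _ (noncompactCoords_mem_rootCoords 2)
  have a4 := hne _ (noncompactCoords_mem_rootCoords 4)
  have a5 := hne _ (noncompactCoords_mem_rootCoords 3)
  have a6 := hne _ (noncompactCoords_mem_rootCoords 6)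
  have a7 := hne _ (noncompactCoords_mem_rootCoords 5)
  have a8 := hne _ (noncompactCoords_mem_rootCoords 7)
  simp [noncompactCoords, dotProduct, Fin.sum_univ_four] at p1 p2 p3 p4 a1 a2 a3 a4 a5 a6 a7 a8
  suffices ∃ i, (0 < h ⬝ᵥ (simpleRoots i).row 0 ∧ 0 < h ⬝ᵥ (simpleRoots i).row 1 ∧
      0 < h ⬝ᵥ (simpleRoots i).row 2 ∧ 0 < h ⬝ᵥ (simpleRoots i).row 3) by
    simpa [Fin.forall_fin_succ] using this
  simp only [simpleRoots, dotProduct, Fin.sum_univ_four]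
  by_cases c1 : 0 < h 0
  · exact ⟨0, by simp; omega⟩
  by_cases c2 : 0 < h 0 + h 1
  · exact ⟨1, by simp; omega⟩
  by_cases c3 : 0 < h 0 + h 1 + h 2
  · exact ⟨2, by simp; omega⟩
  by_cases c5 : 0 < h 0 + h 1 + h 2 + h 3
  · by_cases c4 : 0 < h 0 + h 1 + h 2 * 2
    · exact ⟨3, by simp; omega⟩
    by_cases c6 : 0 < h 0 + h 1 * 2 + h 2 * 2
    · exact ⟨4, by simp; omega⟩
    exact ⟨6, by simp; omega⟩
  by_cases c4 : 0 < h 0 + h 1 + h 2 * 2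
  · exact ⟨5, by simp; omega⟩
  by_cases c6 : 0 < h 0 + h 1 * 2 + h 2 * 2
  · by_cases c7 : 0 < h 0 + h 1 + h 2 * 2 + h 3
    · exact ⟨7, by simp; omega⟩
    by_cases c8 : 0 < h 0 + h 1 + h 2 * 2 + h 3 * 2
    · exact ⟨9, by simp; omega⟩
    exact ⟨11, by simp; omega⟩
  by_cases c7 : 0 < h 0 + h 1 + h 2 * 2 + h 3
  · exact ⟨8, by simp; omega⟩
  exact ⟨10, by simp; omega⟩

lemma n_linearCombination (x : Fin 4 → ℝ) : n (Fintype.linearCombination ℝ φv x) = x := by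
  ext i
  fin_cases i <;>
    simp [Fintype.linearCombination_apply, n, φv, φ₁, φ₂, φ₃, φ₄, e, Fin.sum_univ_four] <;> ring

lemma ker_linearCombination : LinearMap.ker (Fintype.linearCombination ℝ φv) = ⊥ :=
  LinearMap.ker_eq_bot.2 (Function.LeftInverse.injective n_linearCombination)

/-- The vector with the given integral `φ`-coordinates. -/
def ofCoords : (Fin 4 → ℤ) →+ V :=
  (Fintype.linearCombination ℝ φv).toAddMonoidHom.comp ((Int.castAddHom ℝ).compLeft (Fin 4))

lemma ofCoords_apply (r : Fin 4 → ℤ) :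
    ofCoords r = Fintype.linearCombination ℝ φv fun i => (r i : ℝ) := rfl

lemma n_ofCoords (r : Fin 4 → ℤ) (i : Fin 4) : n (ofCoords r) i = r i := by
  rw [ofCoords_apply, n_linearCombination]

lemma ofCoords_injective : Function.Injective ofCoords := fun r s h => by
  ext i
  exact_mod_cast (n_ofCoords r i).symm.trans ((congrFun (congrArg n h) i).trans (n_ofCoords s i))

lemma ofCoords_eq (r : Fin 4 → ℤ) :
    ofCoords r = ![(r 3 : ℝ) / 2, r 0 - (r 3 : ℝ) / 2, r 1 - r 0 - (r 3 : ℝ) / 2,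
      r 2 - r 1 - (r 3 : ℝ) / 2] := by
  ext j
  fin_cases j <;>
    simp [ofCoords_apply, Fintype.linearCombination_apply, φv, φ₁, φ₂, φ₃, φ₄, e,
      Fin.sum_univ_four] <;> ring

lemma ofCoords_shortCoords (i : Fin 4) : ofCoords (shortCoords i) = e i := by
  rw [ofCoords_eq]
  ext j
  fin_cases i <;> fin_cases j <;> simp [shortCoords, e] <;> norm_num

lemma ofCoords_halfSum : ofCoords ![1, 2, 3, 1] = (1 / 2 : ℝ) • ∑ i, e i := by
  rw [ofCoords_eq]
  ext j
  fin_cases j <;> simp [e, Fin.sum_univ_four] <;> norm_num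

lemma half_sum_signs (T : Finset (Fin 4)) :
    (1 / 2 : ℝ) • ∑ i, (if i ∈ T then -1 else 1 : ℝ) • e i =
      ofCoords (![1, 2, 3, 1] - ∑ i ∈ T, shortCoords i) := by
  have h : ∑ i ∈ T, e i = ∑ i, if i ∈ T then e i else 0 := by simp
  simp only [map_sub, map_sum, ofCoords_shortCoords, ofCoords_halfSum, h, Finset.smul_sum,
    ← Finset.sum_sub_distrib]
  refine Finset.sum_congr rfl fun i _ => ?_
  split_ifs <;> module

lemma mem_Δ_iff (α : V) : α ∈ Δ ↔ ∃ r ∈ rootCoords, ofCoords r = α := by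
  constructor
  · rintro ((h | h) | ⟨s, hs, rfl⟩)
    · obtain ⟨i, h⟩ := Set.mem_iUnion.1 h
      have hmem : shortCoords i ∈ rootCoords ∧ -shortCoords i ∈ rootCoords := by
        simp only [rootCoords, mem_union, mem_biUnion]
        exact ⟨.inl (.inl ⟨i, mem_univ _, by simp⟩), .inl (.inl ⟨i, mem_univ _, by simp⟩)⟩
      rcases h with rfl | rfl
      · exact ⟨_, hmem.1, ofCoords_shortCoords i⟩
      · exact ⟨_, hmem.2, by rw [map_neg, ofCoords_shortCoords]⟩
    · simp only [Set.mem_iUnion] at h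
      obtain ⟨i, j, hij, h⟩ := h
      have hmem : ∀ r ∈ ({shortCoords i + shortCoords j, shortCoords i - shortCoords j,
          -shortCoords i + shortCoords j, -shortCoords i - shortCoords j} :
          Finset (Fin 4 → ℤ)), r ∈ rootCoords := fun r hr => by
        simp only [rootCoords, mem_union, mem_biUnion]
        exact .inl (.inr ⟨(i, j), by simpa using hij, hr⟩)
      rcases h with rfl | rfl | rfl | rfl
      · exact ⟨_, hmem (shortCoords i + shortCoords j) (by simp), by simp [ofCoords_shortCoords]⟩
      · exact ⟨_, hmem (shortCoords i - shortCoords j) (by simp), by simp [ofCoords_shortCoords]⟩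
      · exact ⟨_, hmem (-shortCoords i + shortCoords j) (by simp), by simp [ofCoords_shortCoords]⟩
      · exact ⟨_, hmem (-shortCoords i - shortCoords j) (by simp), by simp [ofCoords_shortCoords]⟩
    · classical
      refine ⟨_, mem_union_right _ (mem_image_of_mem _ (mem_univ (univ.filter (s · = -1)))), ?_⟩
      rw [← half_sum_signs]
      congr! 3 with i
      rcases hs i with h | h <;> norm_num [h]
  · rintro ⟨r, hr, rfl⟩
    simp only [rootCoords, mem_union, mem_biUnion, mem_image, mem_univ, true_and, mem_filter,
      mem_insert, mem_singleton] at hr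
    rcases hr with (⟨i, hr⟩ | ⟨⟨i, j⟩, hij, hr⟩) | ⟨T, rfl⟩
    · refine .inl (.inl (Set.mem_iUnion.2 ⟨i, ?_⟩))
      rcases hr with rfl | rfl <;> simp [ofCoords_shortCoords]
    · refine .inl (.inr (Set.mem_iUnion.2 ⟨i, Set.mem_iUnion.2 ⟨j, Set.mem_iUnion.2 ⟨hij, ?_⟩⟩⟩))
      rcases hr with rfl | rfl | rfl | rfl <;> simp [ofCoords_shortCoords]
    · refine .inr ⟨fun i => if i ∈ T then -1 else 1, fun i => ?_, (half_sum_signs T).symm⟩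
      dsimp only
      split_ifs <;> simp

lemma ofCoords_mem_Δ {r : Fin 4 → ℤ} : ofCoords r ∈ Δ ↔ r ∈ rootCoords := by
  simp [mem_Δ_iff, ofCoords_injective.eq_iff]

lemma mem_Δn_iff (α : V) : α ∈ Δn ↔ ∃ t, ofCoords (noncompactCoords t) = α := by
  have h (r : Fin 4 → ℤ) :
      r ∈ rootCoords ∧ Odd (r 0) ↔ ∃ t, noncompactCoords t = r := by
    simpa using (Finset.ext_iff.1 image_noncompactCoords r).symm
  constructor
  · rintro ⟨hα, m, hm⟩
    obtain ⟨r, hr, rfl⟩ := (mem_Δ_iff α).1 hα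
    rw [n_ofCoords] at hm
    obtain ⟨t, rfl⟩ := (h r).1 ⟨hr, m, by exact_mod_cast hm⟩
    exact ⟨t, rfl⟩
  · rintro ⟨t, rfl⟩
    obtain ⟨hr, m, hm⟩ := (h _).2 ⟨t, rfl⟩
    exact ⟨ofCoords_mem_Δ.2 hr, m, by rw [n_ofCoords, hm]; push_cast; rfl⟩

lemma ofCoords_mem_Δkp {r : Fin 4 → ℤ} :
    ofCoords r ∈ Δkp ↔ r ∈ rootCoords ∧ (∀ k, 0 ≤ r k) ∧ Even (r 0) := by
  have h : (∃ m : ℤ, (r 0 : ℝ) = 2 * m) ↔ Even (r 0) := by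
    rw [even_iff_exists_two_mul]
    exact exists_congr fun m => by norm_cast
  simp only [Δkp, Δp, Δk, Set.mem_inter_iff, Set.mem_ofPred_eq, ofCoords_mem_Δ, n_ofCoords, h,
    Int.cast_nonneg_iff]
  exact ⟨fun ⟨⟨hr, hk⟩, _, he⟩ => ⟨hr, hk, he⟩, fun ⟨hr, hk, he⟩ => ⟨⟨hr, hk⟩, hr, he⟩⟩

/-- The `k`-th simple root of the `i`-th base. -/
def simpleRoot (i : Fin 12) (k : Fin 4) : V := ofCoords ((simpleRoots i).row k)

lemma linearIndependent_simpleRoot (i : Fin 12) : LinearIndependent ℝ (simpleRoot i) := by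
  have hu : IsUnit ((simpleRoots i).map (Int.castRingHom ℝ)) :=
    (IsUnit.of_mul_eq_one _ (simpleRoots_mul_coweights i)).map (Int.castRingHom ℝ).mapMatrix
  exact (Matrix.linearIndependent_rows_of_isUnit hu).map' _ ker_linearCombination

lemma simpleRoot_injective (i : Fin 12) : Function.Injective (simpleRoot i) :=
  (linearIndependent_simpleRoot i).injective

lemma sum_smul_simpleRoot (i : Fin 12) (c : Fin 4 → ℤ) :
    ∑ k, (c k : ℝ) • simpleRoot i k = ofCoords (c ᵥ* simpleRoots i) := by
  simp only [simpleRoot, Int.cast_smul_eq_zsmul, ← map_zsmul, ← map_sum]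
  congr 1

lemma ofCoords_eq_sum_iff (i : Fin 12) (r c : Fin 4 → ℤ) :
    ofCoords r = ∑ k, (c k : ℝ) • simpleRoot i k ↔ c = r ᵥ* coweights i := by
  rw [sum_smul_simpleRoot, ofCoords_injective.eq_iff]
  constructor
  · rintro rfl
    rw [vecMul_vecMul, simpleRoots_mul_coweights, vecMul_one]
  · rintro rfl
    rw [vecMul_vecMul, mul_eq_one_comm.1 (simpleRoots_mul_coweights i), vecMul_one]

open scoped Classical in
/-- The `i`-th base as a set of vectors. -/
def base (i : Fin 12) : Finset V := univ.image (simpleRoot i)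

lemma sum_base (i : Fin 12) (f : V → V) : ∑ x ∈ base i, f x = ∑ k, f (simpleRoot i k) :=
  sum_image (simpleRoot_injective i).injOn

lemma forall_mem_base {i : Fin 12} {p : V → Prop} :
    (∀ x ∈ base i, p x) ↔ ∀ k, p (simpleRoot i k) := by
  simp [base]

/-- Integer coefficients over a base can be prescribed as a family indexed by `Fin 4`. -/
lemma exists_coeff_iff (i : Fin 12) (r : Fin 4 → ℤ) (p : (Fin 4 → ℤ) → Prop) :
    (∃ c : V → ℤ, ofCoords r = ∑ x ∈ base i, (c x : ℝ) • x ∧ p (c ∘ simpleRoot i)) ↔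
      p (r ᵥ* coweights i) := by
  constructor
  · rintro ⟨c, hc, hp⟩
    rw [sum_base] at hc
    rwa [← (ofCoords_eq_sum_iff i r (c ∘ simpleRoot i)).1 hc]
  · intro hp
    obtain ⟨c, hc⟩ := (simpleRoot_injective i).surjective_comp_right (r ᵥ* coweights i)
    refine ⟨c, ?_, (congrArg p hc).mpr hp⟩
    rw [sum_base]
    exact (ofCoords_eq_sum_iff i r (c ∘ simpleRoot i)).2 hc

lemma isBase_base (i : Fin 12) : IsBase (base i) := by
  refine ⟨fun x hx => ?_, ?_, fun α hα => ?_⟩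
  · revert x
    exact forall_mem_base.2 fun k => ofCoords_mem_Δ.2 (simpleRoots_mem_rootCoords i k)
  · have h := (linearIndependent_simpleRoot i).linearIndepOn_id
    rwa [← Set.image_univ, ← coe_univ, ← coe_image] at h
  · obtain ⟨r, hr, rfl⟩ := (mem_Δ_iff α).1 hα
    simp only [forall_mem_base]
    exact (exists_coeff_iff i r fun c => (∀ k, 0 ≤ c k) ∨ ∀ k, c k ≤ 0).2
      (coeffs_nonneg_or_nonpos i hr)

lemma Δkp_subset_posOf_base (i : Fin 12) : Δkp ⊆ posOf (base i) := by
  intro α hα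
  obtain ⟨r, -, rfl⟩ := (mem_Δ_iff α).1 hα.1.1
  obtain ⟨hr, hpos, heven⟩ := ofCoords_mem_Δkp.1 hα
  refine ⟨hα.1.1, ?_⟩
  simp only [forall_mem_base]
  exact (exists_coeff_iff i r fun c => ∀ k, 0 ≤ c k).2 (coeffs_nonneg_of_compact i hr hpos heven)

open scoped Classical in
lemma SBG_base (i : Fin 12) (s : Finset (Fin 4)) :
    SBG (base i) (s.image (simpleRoot i)) =
      (ofCoords ∘ noncompactCoords) '' {t | (unionMask (i, s)).testBit t = true} := by
  ext β
  simp only [SBG, Set.mem_ofPred_eq, mem_Δn_iff, exists_mem_image, Set.mem_image, testBit_unionMask]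
  constructor
  · rintro ⟨⟨t, rfl⟩, h⟩
    exact ⟨t, (exists_coeff_iff i _ fun c => ∃ k ∈ s, 0 < c k).1 h, rfl⟩
  · rintro ⟨t, h, rfl⟩
    exact ⟨⟨t, rfl⟩, (exists_coeff_iff i _ fun c => ∃ k ∈ s, 0 < c k).2 h⟩

/-- A base admits a linear functional equal to `1` on all its elements. -/
lemma exists_height {B : Finset V} (hB : LinearIndependent ℝ (Subtype.val : {x // x ∈ B} → V)) :
    ∃ f : V →ₗ[ℝ] ℝ, ∀ b ∈ B, f b = 1 := by
  have hB' : LinearIndepOn ℝ id (B : Set V) := hB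
  let b := Module.Basis.extend hB'
  refine ⟨b.constr ℝ fun _ => (1 : ℝ), fun x hx => ?_⟩
  simpa [b] using b.constr_basis ℝ (fun _ => (1 : ℝ)) ⟨x, Module.Basis.subset_extend hB' hx⟩

/-- A functional that is `1` on a base is integral in terms of the `φ`-coordinates. -/
lemma exists_height_coords {B : Finset V} (hB : IsBase B) {f : V →ₗ[ℝ] ℝ}
    (hf : ∀ b ∈ B, f b = 1) :
    ∃ h : Fin 4 → ℤ, ∀ r, f (ofCoords r) = ((h ⬝ᵥ r : ℤ) : ℝ) := by
  have key (k : Fin 4) : ∃ m : ℤ, f (ofCoords (Pi.single k 1)) = m := by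
    have hk : Pi.single k 1 ∈ rootCoords := by revert k; decide +kernel
    obtain ⟨c, hc, -⟩ := hB.2.2 _ (ofCoords_mem_Δ.2 hk)
    refine ⟨∑ x ∈ B, c x, ?_⟩
    rw [hc, map_sum, Int.cast_sum]
    exact sum_congr rfl fun x hx => by simp [hf x hx]
  choose h hh using key
  refine ⟨h, fun r => ?_⟩
  have hr : r = ∑ k, r k • Pi.single k (1 : ℤ) := by
    ext j; simp [Pi.single_apply]
  conv_lhs => rw [hr]
  simp only [map_sum, map_zsmul, hh, dotProduct, Int.cast_sum, Int.cast_mul]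
  exact sum_congr rfl fun k _ => by rw [zsmul_eq_mul, mul_comm]

/-- If a functional that is `1` on the base `B` is positive on `base i`, then `B = base i`. -/
lemma eq_base_of_height_pos {B : Finset V} (hB : IsBase B) {f : V →ₗ[ℝ] ℝ}
    (hf : ∀ b ∈ B, f b = 1) {h : Fin 4 → ℤ} (hh : ∀ r, f (ofCoords r) = ((h ⬝ᵥ r : ℤ) : ℝ))
    {i : Fin 12} (hi : ∀ k, 0 < h ⬝ᵥ (simpleRoots i).row k) : B = base i := by
  have hsub : B ⊆ base i := by
    intro b hb
    obtain ⟨r, hr, rfl⟩ := (mem_Δ_iff b).1 (hB.1 hb)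
    set c := r ᵥ* coweights i with hc
    have hsum : ∑ k, c k * (h ⬝ᵥ (simpleRoots i).row k) = 1 := by
      have := hf _ hb
      rw [(ofCoords_eq_sum_iff i r c).2 hc, map_sum] at this
      simp only [map_smul, simpleRoot, hh, smul_eq_mul] at this
      exact_mod_cast this
    have hnonneg : ∀ k, 0 ≤ c k := by
      refine (coeffs_nonneg_or_nonpos i hr).resolve_right fun hneg => ?_
      have : ∑ k, c k * (h ⬝ᵥ (simpleRoots i).row k) ≤ 0 :=
        sum_nonpos fun k _ => mul_nonpos_of_nonpos_of_nonneg (hneg k) (hi k).le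
      omega
    have hle : ∑ k, c k ≤ 1 := hsum ▸ sum_le_sum fun k _ =>
      le_mul_of_one_le_right (hnonneg k) (hi k)
    obtain ⟨k, hk⟩ : ∃ k, c k ≠ 0 := by
      by_contra! h0
      simp [h0] at hsum
    have hck : c = Pi.single k 1 := by
      have hsplit := add_sum_erase univ c (mem_univ k)
      have hrest : 0 ≤ ∑ j ∈ univ.erase k, c j := sum_nonneg fun j _ => hnonneg j
      have hkpos := lt_of_le_of_ne (hnonneg k) hk.symm
      ext j
      by_cases hj : j = k
      · subst hj
        rw [Pi.single_eq_same]
        omega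
      · rw [Pi.single_eq_of_ne hj]
        exact (sum_eq_zero_iff_of_nonneg fun j _ => hnonneg j).1
          (by omega : ∑ j ∈ univ.erase k, c j = 0) j (by simp [hj])
    rw [(ofCoords_eq_sum_iff i r c).2 hc, hck]
    simp [base, Pi.single_apply]
  refine hsub.antisymm fun x hx => by_contra fun hxB => ?_
  obtain ⟨c, hc, -⟩ := hB.2.2 x ((isBase_base i).1 hx)
  have hli : LinearIndepOn ℝ id (base i : Set V) := (isBase_base i).2.1
  refine ((linearIndepOn_id_insert (by simpa using hxB)).1
    (hli.mono (Set.insert_subset hx (coe_subset.2 hsub)))).2 ?_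
  rw [hc]
  exact Submodule.sum_mem _ fun y hy => Submodule.smul_mem _ _ (Submodule.subset_span hy)

lemma exists_eq_base {B : Finset V} (hB : IsBase B) (hpos : Δkp ⊆ posOf B) :
    ∃ i, B = base i := by
  obtain ⟨f, hf⟩ := exists_height hB.2.1
  obtain ⟨h, hh⟩ := exists_height_coords hB hf
  have hsum (c : V → ℤ) : f (∑ x ∈ B, (c x : ℝ) • x) = ((∑ x ∈ B, c x : ℤ) : ℝ) := by
    rw [map_sum, Int.cast_sum]
    exact sum_congr rfl fun x hx => by simp [hf x hx]
  have hne : ∀ r ∈ rootCoords, h ⬝ᵥ r ≠ 0 := fun r hr h0 => by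
    obtain ⟨c, hc, hsign⟩ := hB.2.2 _ (ofCoords_mem_Δ.2 hr)
    have hc0 : ∑ x ∈ B, c x = 0 := by
      have := hsum c
      rw [← hc, hh, h0] at this
      exact_mod_cast this.symm
    have hzero : ∀ x ∈ B, c x = 0 := by
      rcases hsign with hs | hs
      · exact (sum_eq_zero_iff_of_nonneg hs).1 hc0
      · exact (sum_eq_zero_iff_of_nonpos hs).1 hc0
    have : ofCoords r = 0 := hc.trans (sum_eq_zero fun x hx => by simp [hzero x hx])
    rw [(map_eq_zero_iff _ ofCoords_injective).1 this] at hr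
    exact absurd hr (by decide +kernel)
  obtain ⟨i, hi⟩ := exists_chamber h hne fun r hr hr0 heven => by
    obtain ⟨-, c, hc, hnonneg⟩ := hpos (ofCoords_mem_Δkp.2 ⟨hr, hr0, heven⟩)
    refine lt_of_le_of_ne ?_ (hne r hr).symm
    have := hsum c
    rw [← hc, hh] at this
    rw [Int.cast_injective this]
    exact sum_nonneg hnonneg
  exact ⟨i, eq_base_of_height_pos hB hf hh hi⟩

lemma injOn_setOf_testBit :
    Set.InjOn (fun m : ℕ => (ofCoords ∘ noncompactCoords) '' {t : Fin 28 | m.testBit t = true})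
      (univ.image unionMask : Finset ℕ) := by
  have hlt : ∀ m ∈ (univ.image unionMask : Finset ℕ), m < 2 ^ 28 := by
    intro m hm
    obtain ⟨p, -, rfl⟩ := mem_image.1 hm
    exact unionMask_lt p
  intro m hm m' hm' h
  have h := (ofCoords_injective.comp noncompactCoords_injective).image_injective h
  refine Nat.eq_of_testBit_eq fun j => ?_
  by_cases hj : j < 28
  · exact Bool.eq_iff_iff.2 (Set.ext_iff.1 h ⟨j, hj⟩)
  · have hle : 2 ^ 28 ≤ 2 ^ j := Nat.pow_le_pow_right two_pos (not_lt.1 hj)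
    rw [Nat.testBit_lt_two_pow ((hlt m hm).trans_le hle),
      Nat.testBit_lt_two_pow ((hlt m' hm').trans_le hle)]

theorem stmt17 :
    {S : Set V | ∃ B Γ : Finset V,
      IsBase B ∧ Δkp ⊆ posOf B ∧ Γ ⊆ B ∧ S = SBG B Γ}.ncard = 46 := by
  classical
  have : {S : Set V | ∃ B Γ : Finset V, IsBase B ∧ Δkp ⊆ posOf B ∧ Γ ⊆ B ∧ S = SBG B Γ} =
      (fun m : ℕ => (ofCoords ∘ noncompactCoords) '' {t : Fin 28 | m.testBit t = true}) ''
        (univ.image unionMask : Finset ℕ) := by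
    ext S
    simp only [Set.mem_ofPred_eq, coe_image, coe_univ, Set.image_univ, Set.mem_image,
      Set.exists_range_iff]
    constructor
    · rintro ⟨B, Γ, hB, hpos, hΓ, rfl⟩
      obtain ⟨i, rfl⟩ := exists_eq_base hB hpos
      obtain ⟨s, -, rfl⟩ := subset_image_iff.1 hΓ
      exact ⟨(i, s), by convert (SBG_base i s).symm⟩
    · rintro ⟨⟨i, s⟩, rfl⟩
      exact ⟨base i, s.image (simpleRoot i), isBase_base i, Δkp_subset_posOf_base i,
        by unfold base; convert image_subset_image (subset_univ s), by convert (SBG_base i s).symm⟩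
  rw [this, injOn_setOf_testBit.ncard_image, Set.ncard_coe_finset, card_image_unionMask]
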